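/- arXiv:2101.06154 — 3 statements merged into one kernel-verified Lean document; each statement's English description precedes it below -/
import Mathlib

section
/- Fix integers n₀, n₁, m ≥ 1, reals p, q with 1 ≤ p < ∞ and 0 < q ≤ ∞, and μ > 0, and let p* be the Hölder conjugate of p. Let α ∈ ℝ^{4^{n₁}}, let v₁, …, v_m ∈ ℝ^{4^{n₀}}, and let 𝒞 be any nonempty set of 4^{n₁}×4^{n₀} real matrices such that ‖M‖_{p,q} ≤ μ for every M ∈ 𝒞. Define R = 2^{−m} ∑_{ε ∈ {−1,1}^m} (1/m) · sup_{M ∈ 𝒞} |∑_{i=1}^m ε_i · (α · (M v_i))|. Then: (1) if 1 ≤ p ≤ 2, R ≤ μ · 4^{n₁·max{1/p*, 1/q}} · (√(min{p*, 8n₀})/√m) · ‖α‖_p · max_i ‖v_i‖_{p*}; and (2) if 2 < p < ∞, R ≤ μ · 4^{n₁·max{1/p*, 1/q}} · (√(p*)/m^{1/p}) · ‖α‖_p · max_i ‖v_i‖_{p*}. (This is the paper's Theorem 1 on the Rademacher complexity of quantum circuits of bounded (p,q) group norm: there 𝒞 is the set of Pauli-basis representation matrices of quantum circuits from n₀ to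 n₁ qubits, α is the Pauli representation vector of the observable H, v_i that of the input state |ψ(x_i)⟩⟨ψ(x_i)|, and f_M(x_i) = α·(M v_i).) -/
open scoped ENNReal BigOperators
open Matrix

/-- The `l_p` norm of a finitely-indexed real vector, for `0 < p ≤ ∞`
(for `p = ∞` it is the max of the absolute values of the entries). -/
noncomputable def vecLpNorm {ι : Type*} [Fintype ι] (p : ℝ≥0∞) (w : ι → ℝ) : ℝ :=
  if p = ∞ then ⨆ j, |w j| else (∑ j, |w j| ^ p.toReal) ^ (1 / p.toReal)

/-- The `(p,q)` group norm of a real matrix: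
`‖M‖_{p,q} = ((1/N₁) ∑_i ‖M_i‖_p^q)^{1/q}`, with `‖M‖_{p,∞} = max_i ‖M_i‖_p`. -/
noncomputable def groupNorm {ι κ : Type*} [Fintype ι] [Fintype κ]
    (p q : ℝ≥0∞) (M : Matrix ι κ ℝ) : ℝ :=
  if q = ∞ then ⨆ i, vecLpNorm p (M i)
  else ((Fintype.card ι : ℝ)⁻¹ * ∑ i, vecLpNorm p (M i) ^ q.toReal) ^ (1 / q.toReal)

/-- The Hölder conjugate `p*` of a real `p ≥ 1`, as an extended nonnegative real
(so that `1* = ∞`). -/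
noncomputable def hconj (p : ℝ) : ℝ≥0∞ :=
  if p = 1 then ∞ else ENNReal.ofReal (p / (p - 1))

/-- `min {p*, 8 n₀}`, interpreted as `8 n₀` when `p* = ∞` (i.e. when `p = 1`). -/
noncomputable def minConj (p : ℝ) (n₀ : ℕ) : ℝ :=
  if p = 1 then 8 * n₀ else min (p / (p - 1)) (8 * n₀)

/-- The sign `±1` encoded by a Boolean. -/
noncomputable def boolSign (b : Bool) : ℝ := if b then 1 else -1

theorem vecLpNorm_top {ι : Type*} [Fintype ι] (w : ι → ℝ) : vecLpNorm ∞ w = ⨆ j, |w j| := by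
  simp [vecLpNorm]

theorem vecLpNorm_ofReal {ι : Type*} [Fintype ι] {r : ℝ} (hr : 0 ≤ r) (w : ι → ℝ) :
    vecLpNorm (ENNReal.ofReal r) w = (∑ j, |w j| ^ r) ^ (1 / r) := by
  simp [vecLpNorm, ENNReal.toReal_ofReal hr]

theorem vecLpNorm_nonneg {ι : Type*} [Fintype ι] (p : ℝ≥0∞) (w : ι → ℝ) : 0 ≤ vecLpNorm p w := by
  unfold vecLpNorm
  split_ifs
  · exact Real.iSup_nonneg fun _ => abs_nonneg _
  · positivity

theorem vecLpNorm_ofReal_rpow {ι : Type*} [Fintype ι] {r : ℝ} (hr : 0 < r) (w : ι → ℝ) :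
    vecLpNorm (ENNReal.ofReal r) w ^ r = ∑ j, |w j| ^ r := by
  rw [vecLpNorm_ofReal hr.le, one_div, Real.rpow_inv_rpow (by positivity) hr.ne']

theorem abs_le_vecLpNorm_top {ι : Type*} [Fintype ι] (w : ι → ℝ) (j : ι) :
    |w j| ≤ vecLpNorm ∞ w := by
  rw [vecLpNorm_top]
  exact le_ciSup (f := fun j => |w j|) (Set.finite_range _).bddAbove j

theorem abs_le_vecLpNorm_ofReal {ι : Type*} [Fintype ι] {r : ℝ} (hr : 0 < r) (w : ι → ℝ) (j : ι) :
    |w j| ≤ vecLpNorm (ENNReal.ofReal r) w := by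
  rw [← Real.rpow_le_rpow_iff (abs_nonneg _) (vecLpNorm_nonneg _ _) hr, vecLpNorm_ofReal_rpow hr]
  exact Finset.single_le_sum (f := fun j => |w j| ^ r) (fun _ _ => by positivity)
    (Finset.mem_univ j)

theorem vecLpNorm_mono {ι : Type*} [Fintype ι] (p : ℝ≥0∞) {w z : ι → ℝ}
    (h : ∀ i, |w i| ≤ |z i|) : vecLpNorm p w ≤ vecLpNorm p z := by
  unfold vecLpNorm
  split_ifs
  · exact ciSup_mono (Set.finite_range _).bddAbove h
  · have := p.toReal_nonneg
    exact Real.rpow_le_rpow (by positivity) (Finset.sum_le_sum fun i _ =>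
      Real.rpow_le_rpow (abs_nonneg _) (h i) this) (by positivity)

theorem vecLpNorm_mul_const {ι : Type*} [Fintype ι] {p : ℝ≥0∞} (hp : 0 < p) (w : ι → ℝ) {c : ℝ}
    (hc : 0 ≤ c) : vecLpNorm p (fun i => w i * c) = vecLpNorm p w * c := by
  unfold vecLpNorm
  split_ifs with h
  · simp_rw [abs_mul, abs_of_nonneg hc, Real.iSup_mul_of_nonneg hc]
  · have := ENNReal.toReal_pos hp.ne' h
    simp_rw [abs_mul, abs_of_nonneg hc, Real.mul_rpow (abs_nonneg _) hc, ← Finset.sum_mul]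
    rw [Real.mul_rpow (by positivity) (by positivity), one_div, Real.rpow_rpow_inv hc this.ne']

theorem vecLpNorm_antitone {ι : Type*} [Fintype ι] {s t : ℝ≥0∞} (hs : 0 < s) (hst : s ≤ t)
    (w : ι → ℝ) : vecLpNorm t w ≤ vecLpNorm s w := by
  rcases eq_or_ne s ∞ with rfl | hs'
  · rw [top_le_iff.1 hst]
  lift s to NNReal using hs'
  have hs0 : 0 < (s : ℝ) := by exact_mod_cast hs
  have key : ∀ j, |w j| ≤ vecLpNorm s w := fun j => by
    simpa using abs_le_vecLpNorm_ofReal hs0 w j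
  have hpow : vecLpNorm s w ^ (s : ℝ) = ∑ j, |w j| ^ (s : ℝ) := by
    simpa using vecLpNorm_ofReal_rpow hs0 w
  rcases eq_or_ne t ∞ with rfl | ht'
  · rw [vecLpNorm_top]
    exact Real.iSup_le key (vecLpNorm_nonneg _ _)
  lift t to NNReal using ht'
  have hst' : (s : ℝ) ≤ t := by exact_mod_cast hst
  have ht0 : 0 < (t : ℝ) := hs0.trans_le hst'
  have hpow' : vecLpNorm t w ^ (t : ℝ) = ∑ j, |w j| ^ (t : ℝ) := by
    simpa using vecLpNorm_ofReal_rpow ht0 w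
  rw [← Real.rpow_le_rpow_iff (vecLpNorm_nonneg _ _) (vecLpNorm_nonneg _ _) ht0, hpow']
  have hA := vecLpNorm_nonneg s w
  calc ∑ j, |w j| ^ (t : ℝ) = ∑ j, |w j| ^ (s : ℝ) * |w j| ^ ((t : ℝ) - s) := by
        refine Finset.sum_congr rfl fun j _ => ?_
        rw [← Real.rpow_add_of_nonneg (abs_nonneg _) hs0.le (by linarith)]
        congr 1; ring
    _ ≤ ∑ j, |w j| ^ (s : ℝ) * vecLpNorm s w ^ ((t : ℝ) - s) := by
        gcongr with j
        exact key j
    _ = vecLpNorm s w ^ (t : ℝ) := by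
        rw [← Finset.sum_mul, ← hpow, ← Real.rpow_add_of_nonneg hA hs0.le (by linarith)]
        congr 1; ring

theorem vecLpNorm_le_card_rpow_mul {ι : Type*} [Fintype ι] {s t : ℝ≥0∞} (hs : 0 < s) (hst : s ≤ t)
    (w : ι → ℝ) :
    vecLpNorm s w ≤ (Fintype.card ι : ℝ) ^ (s⁻¹.toReal - t⁻¹.toReal) * vecLpNorm t w := by
  rcases eq_or_ne s ∞ with rfl | hs'
  · rw [top_le_iff.1 hst]; simp
  lift s to NNReal using hs'
  have hs0 : 0 < (s : ℝ) := by exact_mod_cast hs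
  have hpow : vecLpNorm s w ^ (s : ℝ) = ∑ j, |w j| ^ (s : ℝ) := by
    simpa using vecLpNorm_ofReal_rpow hs0 w
  have hsr : (s : ℝ≥0∞)⁻¹.toReal = (s : ℝ)⁻¹ := by simp
  have hN : 0 ≤ (Fintype.card ι : ℝ) := by positivity
  rcases eq_or_ne t ∞ with rfl | ht'
  · have hT := vecLpNorm_nonneg ∞ w
    rw [← Real.rpow_le_rpow_iff (vecLpNorm_nonneg _ _) (by positivity) hs0, hpow, hsr,
      Real.mul_rpow (by positivity) hT]
    simp only [ENNReal.inv_top, ENNReal.toReal_zero, sub_zero]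
    rw [Real.rpow_inv_rpow hN hs0.ne']
    calc ∑ j, |w j| ^ (s : ℝ) ≤ ∑ _j : ι, vecLpNorm ∞ w ^ (s : ℝ) := by
          gcongr with j
          exact abs_le_vecLpNorm_top w j
      _ = _ := by simp
  lift t to NNReal using ht'
  have hst' : (s : ℝ) ≤ t := by exact_mod_cast hst
  have ht0 : 0 < (t : ℝ) := hs0.trans_le hst'
  have hpow' : vecLpNorm t w ^ (t : ℝ) = ∑ j, |w j| ^ (t : ℝ) := by
    simpa using vecLpNorm_ofReal_rpow ht0 w
  have htr : (t : ℝ≥0∞)⁻¹.toReal = (t : ℝ)⁻¹ := by simp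
  have hT := vecLpNorm_nonneg t w
  have hS := vecLpNorm_nonneg s w
  rw [← Real.rpow_le_rpow_iff hS (by positivity) ht0, hsr, htr,
      Real.mul_rpow (by positivity) hT, hpow', ← Real.rpow_mul hN]
  have h := Real.rpow_sum_le_const_mul_sum_rpow_of_nonneg (s := Finset.univ)
    (f := fun j => |w j| ^ (s : ℝ)) (p := (t : ℝ) / s) ((one_le_div hs0).2 hst')
    (fun _ _ => by positivity)
  rw [← hpow, ← Real.rpow_mul hS, mul_div_cancel₀ _ hs0.ne'] at h
  refine h.trans_eq ?_
  simp_rw [← Real.rpow_mul (abs_nonneg _), mul_div_cancel₀ _ hs0.ne']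
  congr 2
  field_simp

theorem groupNorm_eq {ι κ : Type*} [Fintype ι] [Fintype κ] (p q : ℝ≥0∞) (M : Matrix ι κ ℝ) :
    groupNorm p q M =
      (Fintype.card ι : ℝ) ^ (-q⁻¹.toReal) * vecLpNorm q (fun i => vecLpNorm p (M i)) := by
  unfold groupNorm
  split_ifs with h
  · subst h
    simp [vecLpNorm_top, abs_of_nonneg (vecLpNorm_nonneg _ _)]
  · have h0 : 0 ≤ ∑ i, vecLpNorm p (M i) ^ q.toReal :=
      Finset.sum_nonneg fun i _ => Real.rpow_nonneg (vecLpNorm_nonneg _ _) _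
    rw [Real.mul_rpow (by positivity) h0, vecLpNorm, if_neg h]
    simp_rw [abs_of_nonneg (vecLpNorm_nonneg _ _)]
    rw [ENNReal.toReal_inv, Real.rpow_neg (by positivity), one_div, Real.inv_rpow (by positivity)]

theorem vecLpNorm_rows_le {ι κ : Type*} [Fintype ι] [Nonempty ι] [Fintype κ] {p q r : ℝ≥0∞}
    (hq : 0 < q) (hr : 0 < r) (M : Matrix ι κ ℝ) :
    vecLpNorm r (fun i => vecLpNorm p (M i)) ≤
      (Fintype.card ι : ℝ) ^ (max r⁻¹.toReal q⁻¹.toReal) * groupNorm p q M := by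
  have hN : 0 < (Fintype.card ι : ℝ) := by exact_mod_cast Fintype.card_pos
  rw [groupNorm_eq, ← mul_assoc, ← Real.rpow_add hN]
  rcases le_total r q with h | h
  · have h' : q⁻¹.toReal ≤ r⁻¹.toReal :=
      ENNReal.toReal_mono (ENNReal.inv_ne_top.2 hr.ne') (ENNReal.inv_le_inv.2 h)
    rw [max_eq_left h', ← sub_eq_add_neg]
    exact vecLpNorm_le_card_rpow_mul hr h _
  · have h' : r⁻¹.toReal ≤ q⁻¹.toReal :=
      ENNReal.toReal_mono (ENNReal.inv_ne_top.2 hq.ne') (ENNReal.inv_le_inv.2 h)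
    rw [max_eq_right h', add_neg_cancel, Real.rpow_zero, one_mul]
    exact vecLpNorm_antitone hq h _

theorem hconj_pos {p : ℝ} (hp : 1 ≤ p) : 0 < hconj p := by
  unfold hconj
  split_ifs with h
  · simp
  · have : 1 < p := lt_of_le_of_ne hp (Ne.symm h)
    have : 0 < p - 1 := by linarith
    simp only [ENNReal.ofReal_pos]
    positivity

theorem hconj_inv_toReal {p : ℝ} (hp : 1 ≤ p) : (hconj p)⁻¹.toReal = 1 - 1 / p := by
  unfold hconj
  split_ifs with h
  · simp [h]
  · have : 1 < p := lt_of_le_of_ne hp (Ne.symm h)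
    have h1 : 0 < p - 1 := by linarith
    rw [ENNReal.toReal_inv, ENNReal.toReal_ofReal (by positivity)]
    field_simp

theorem abs_dotProduct_le {ι : Type*} [Fintype ι] {p : ℝ} (hp : 1 ≤ p) (x y : ι → ℝ) :
    |x ⬝ᵥ y| ≤ vecLpNorm (ENNReal.ofReal p) x * vecLpNorm (hconj p) y := by
  have h0 : |x ⬝ᵥ y| ≤ ∑ i, |x i| * |y i| := by
    simp_rw [← abs_mul]
    exact Finset.abs_sum_le_sum_abs _ _
  refine h0.trans ?_
  unfold hconj
  split_ifs with h
  · subst h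
    rw [vecLpNorm_ofReal zero_le_one]
    simp only [Real.rpow_one, div_one, Finset.sum_mul]
    gcongr with i
    exact abs_le_vecLpNorm_top y i
  · have h1 : 1 < p := lt_of_le_of_ne hp (Ne.symm h)
    have h2 : 0 < p - 1 := by linarith
    rw [vecLpNorm_ofReal (by positivity), vecLpNorm_ofReal (by positivity)]
    exact Real.inner_le_Lp_mul_Lq_of_nonneg _ (Real.HolderConjugate.conjExponent h1)
      (fun _ _ => abs_nonneg _) (fun _ _ => abs_nonneg _)

theorem abs_dotProduct_mulVec_le {ι κ : Type*} [Fintype ι] [Nonempty ι] [Fintype κ] {p : ℝ}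
    {q : ℝ≥0∞} (hp : 1 ≤ p) (hq : 0 < q) (M : Matrix ι κ ℝ) (x : ι → ℝ) (u : κ → ℝ) :
    |x ⬝ᵥ M.mulVec u| ≤ vecLpNorm (ENNReal.ofReal p) x *
      ((Fintype.card ι : ℝ) ^ (max (1 - 1 / p) q⁻¹.toReal) *
        groupNorm (ENNReal.ofReal p) q M * vecLpNorm (hconj p) u) := by
  refine (abs_dotProduct_le hp _ _).trans ?_
  have hu := vecLpNorm_nonneg (hconj p) u
  refine mul_le_mul_of_nonneg_left ?_ (vecLpNorm_nonneg _ _)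
  calc vecLpNorm (hconj p) (M.mulVec u)
      ≤ vecLpNorm (hconj p)
          (fun i => vecLpNorm (ENNReal.ofReal p) (M i) * vecLpNorm (hconj p) u) := by
        refine vecLpNorm_mono _ fun i => (abs_dotProduct_le hp (M i) u).trans (le_abs_self _)
    _ = vecLpNorm (hconj p) (fun i => vecLpNorm (ENNReal.ofReal p) (M i)) *
          vecLpNorm (hconj p) u := vecLpNorm_mul_const (hconj_pos hp) _ hu
    _ ≤ _ := by
        gcongr
        rw [← hconj_inv_toReal hp]
        exact vecLpNorm_rows_le hq (hconj_pos hp) M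

/-- Even moments of a standard Gaussian, `(2k)! / (2^k k!)`. -/
noncomputable def gaussianMoment (k : ℕ) : ℝ := ((2 * k).factorial : ℝ) / (2 ^ k * k.factorial)

theorem gaussianMoment_nonneg (k : ℕ) : 0 ≤ gaussianMoment k := by
  unfold gaussianMoment; positivity

theorem gaussianMoment_succ (k : ℕ) :
    gaussianMoment (k + 1) = (2 * k + 1) * gaussianMoment k := by
  unfold gaussianMoment
  rw [show 2 * (k + 1) = 2 * k + 1 + 1 by ring, Nat.factorial_succ, Nat.factorial_succ,
    Nat.factorial_succ]
  push_cast
  field_simp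
  ring

theorem gaussianMoment_succ_le {k : ℕ} (hk : 1 ≤ k) :
    gaussianMoment (k + 1) ≤ (2 * k : ℝ) ^ (k + 1) := by
  induction k, hk using Nat.le_induction with
  | base => norm_num [gaussianMoment, Nat.factorial]
  | succ n hn ih =>
    rw [gaussianMoment_succ]
    have hn' : (0 : ℝ) ≤ n := by positivity
    calc (2 * ((n + 1 : ℕ) : ℝ) + 1) * gaussianMoment (n + 1)
        ≤ (2 * ((n + 1 : ℕ) : ℝ) + 1) * (2 * n : ℝ) ^ (n + 1) := by gcongr
      _ = ((2 * n + 3) * (2 * n)) * (2 * n : ℝ) ^ n := by push_cast; ring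
      _ ≤ (2 * (n + 1)) ^ 2 * (2 * (n + 1) : ℝ) ^ n := by
          gcongr
          · nlinarith
          · linarith
      _ = _ := by push_cast; ring

theorem choose_mul_gaussianMoment_le (j l : ℕ) :
    ((2 * (j + l)).choose (2 * j) : ℝ) * gaussianMoment l ≤
      gaussianMoment (j + l) * ((j + l).choose j) := by
  have h1 : ((2 * (j + l)).choose (2 * j) : ℝ) =
      (2 * (j + l)).factorial / ((2 * j).factorial * (2 * l).factorial) := by
    rw [Nat.cast_choose ℝ (by lia), show 2 * (j + l) - 2 * j = 2 * l by lia]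
  have h2 : ((j + l).choose j : ℝ) = (j + l).factorial / (j.factorial * l.factorial) := by
    rw [Nat.cast_choose ℝ (by lia), Nat.add_sub_cancel_left]
  have h3 : (2 : ℝ) ^ j * j.factorial ≤ (2 * j).factorial := by
    exact_mod_cast Nat.two_pow_mul_factorial_le_factorial_two_mul j
  rw [h1, h2, gaussianMoment, gaussianMoment]
  have e1 : ((2 * (j + l)).factorial : ℝ) / ((2 * j).factorial * (2 * l).factorial) *
      ((2 * l).factorial / (2 ^ l * l.factorial)) =
      (2 * (j + l)).factorial / ((2 ^ l * l.factorial) * (2 * j).factorial) := by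
    field_simp
  have e2 : ((2 * (j + l)).factorial : ℝ) / (2 ^ (j + l) * (j + l).factorial) *
      ((j + l).factorial / (j.factorial * l.factorial)) =
      (2 * (j + l)).factorial / ((2 ^ l * l.factorial) * (2 ^ j * j.factorial)) := by
    rw [pow_add]; field_simp
  rw [e1, e2]
  gcongr

theorem add_pow_add_sub_pow_even (x b : ℝ) (k : ℕ) :
    (x + b) ^ (2 * k) + (x - b) ^ (2 * k) =
      2 * ∑ j ∈ Finset.range (k + 1),
        b ^ (2 * j) * x ^ (2 * (k - j)) * ((2 * k).choose (2 * j)) := by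
  have hsplit : ∀ (f : ℕ → ℝ) (n : ℕ), ∑ i ∈ Finset.range (2 * n + 1), f i =
      ∑ j ∈ Finset.range (n + 1), f (2 * j) + ∑ j ∈ Finset.range n, f (2 * j + 1) := by
    intro f n
    induction n with
    | zero => simp
    | succ n ih =>
      rw [show 2 * (n + 1) + 1 = 2 * n + 1 + 1 + 1 by ring, Finset.sum_range_succ,
        Finset.sum_range_succ, ih, Finset.sum_range_succ _ (n + 1), Finset.sum_range_succ _ n,
        Finset.sum_range_succ _ n, show 2 * (n + 1) = 2 * n + 1 + 1 by ring]
      ring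
  rw [sub_eq_add_neg, add_comm x b, add_comm x (-b), add_pow, add_pow, hsplit, hsplit]
  have h1 : ∀ j, (-b) ^ (2 * j) = b ^ (2 * j) := fun j => (even_two_mul j).neg_pow b
  have h2 : ∀ j, (-b) ^ (2 * j + 1) = -b ^ (2 * j + 1) := fun j => (odd_two_mul_add_one j).neg_pow b
  simp only [h1, h2, neg_mul, Finset.sum_neg_distrib, Nat.mul_sub]
  ring

theorem sum_boolSign_pow_even_le (k : ℕ) {m : ℕ} (a : Fin m → ℝ) :
    ((2 : ℝ) ^ m)⁻¹ * ∑ ε : Fin m → Bool, (∑ i, boolSign (ε i) * a i) ^ (2 * k) ≤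
      gaussianMoment k * (∑ i, a i ^ 2) ^ k := by
  induction m generalizing k with
  | zero =>
    rcases k with _ | k
    · simp [gaussianMoment]
    · simp
  | succ m ih =>
    have e : ∑ ε : Fin (m + 1) → Bool, (∑ i, boolSign (ε i) * a i) ^ (2 * k) =
        ∑ ε : Fin m → Bool, ((∑ i, boolSign (ε i) * a i.succ + a 0) ^ (2 * k) +
          (∑ i, boolSign (ε i) * a i.succ - a 0) ^ (2 * k)) := by
      rw [← (Fin.consEquiv fun _ => Bool).sum_comp, Fintype.sum_prod_type_right]
      refine Finset.sum_congr rfl fun ε _ => ?_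
      simp [Fin.consEquiv, Fin.sum_univ_succ, boolSign]
      ring
    rw [e]
    simp_rw [add_pow_add_sub_pow_even]
    rw [← Finset.mul_sum, Finset.sum_comm, Fin.sum_univ_succ, add_pow, Finset.mul_sum]
    set τ := ∑ i : Fin m, a i.succ ^ 2
    rw [Finset.mul_sum, Finset.mul_sum]
    refine Finset.sum_le_sum fun j hj => ?_
    obtain ⟨l, rfl⟩ := Nat.exists_eq_add_of_le (Nat.lt_succ_iff.1 (Finset.mem_range.1 hj))
    rw [Nat.add_sub_cancel_left, ← Finset.sum_mul, ← Finset.mul_sum, pow_succ]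
    have hτ : 0 ≤ τ := Finset.sum_nonneg fun _ _ => sq_nonneg _
    have hb : 0 ≤ a 0 ^ (2 * j) := (even_two_mul j).pow_nonneg _
    calc _ = a 0 ^ (2 * j) * ((2 * (j + l)).choose (2 * j)) * (((2 : ℝ) ^ m)⁻¹ *
          ∑ ε : Fin m → Bool, (∑ i, boolSign (ε i) * a i.succ) ^ (2 * l)) := by
          field_simp
      _ ≤ a 0 ^ (2 * j) * ((2 * (j + l)).choose (2 * j)) * (gaussianMoment l * τ ^ l) := by
          exact mul_le_mul_of_nonneg_left (ih l _) (by positivity)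
      _ = (a 0 ^ (2 * j) * τ ^ l) * (((2 * (j + l)).choose (2 * j)) * gaussianMoment l) := by ring
      _ ≤ (a 0 ^ (2 * j) * τ ^ l) * (gaussianMoment (j + l) * ((j + l).choose j)) := by
          exact mul_le_mul_of_nonneg_left (choose_mul_gaussianMoment_le j l) (by positivity)
      _ = _ := by rw [pow_mul]; ring

theorem sign_mean_le_rpow_mean {m : ℕ} {r : ℝ} (hr : 1 ≤ r) (X : (Fin m → Bool) → ℝ)
    (hX : ∀ ε, 0 ≤ X ε) :
    ((2 : ℝ) ^ m)⁻¹ * ∑ ε, X ε ≤ (((2 : ℝ) ^ m)⁻¹ * ∑ ε, X ε ^ r) ^ (1 / r) := by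
  simp_rw [Finset.mul_sum]
  exact Real.arith_mean_le_rpow_mean _ _ _ (fun _ _ => by positivity) (by simp)
    (fun ε _ => hX ε) hr

theorem sum_abs_boolSign_rpow_le_of_even {m k : ℕ} {r : ℝ} (hr : 0 < r) (hk : 1 ≤ k)
    (hrk : r ≤ 2 * k) (a : Fin m → ℝ) :
    ((2 : ℝ) ^ m)⁻¹ * ∑ ε : Fin m → Bool, |∑ i, boolSign (ε i) * a i| ^ r ≤
      (gaussianMoment k * (∑ i, a i ^ 2) ^ k) ^ (r / (2 * k)) := by
  have hk' : (0 : ℝ) < k := by exact_mod_cast hk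
  refine (sign_mean_le_rpow_mean (r := 2 * k / r) ((one_le_div hr).2 hrk) _
    fun _ => by positivity).trans ?_
  rw [one_div_div]
  refine Real.rpow_le_rpow (by positivity) ?_ (by positivity)
  refine le_trans (le_of_eq ?_) (sum_boolSign_pow_even_le k a)
  congr 1
  refine Finset.sum_congr rfl fun ε _ => ?_
  rw [← Real.rpow_mul (abs_nonneg _), mul_div_cancel₀ _ hr.ne', ← (even_two_mul k).pow_abs,
    ← Real.rpow_natCast]
  push_cast
  rfl

/-- Khintchine's inequality with constant `√r`, for real exponents `r ≥ 2`. -/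
theorem khintchine {m : ℕ} {r : ℝ} (hr : 2 ≤ r) (a : Fin m → ℝ) :
    ((2 : ℝ) ^ m)⁻¹ * ∑ ε : Fin m → Bool, |∑ i, boolSign (ε i) * a i| ^ r ≤
      (r * ∑ i, a i ^ 2) ^ (r / 2) := by
  have hr0 : 0 < r := by linarith
  set k := ⌊r / 2⌋₊
  have hk : 1 ≤ k := Nat.le_floor (by push_cast; linarith)
  have h1 : (k : ℝ) ≤ r / 2 := Nat.floor_le (by linarith)
  have h2 : r / 2 < k + 1 := Nat.lt_floor_add_one _
  have hσ : 0 ≤ ∑ i, a i ^ 2 := Finset.sum_nonneg fun _ _ => sq_nonneg _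
  refine (sum_abs_boolSign_rpow_le_of_even hr0 (Nat.le_add_left 1 k)
    (by push_cast; linarith) a).trans ?_
  have hg := gaussianMoment_nonneg (k + 1)
  calc (gaussianMoment (k + 1) * (∑ i, a i ^ 2) ^ (k + 1)) ^ (r / (2 * ((k + 1 : ℕ) : ℝ)))
      ≤ ((r : ℝ) ^ (k + 1) * (∑ i, a i ^ 2) ^ (k + 1)) ^ (r / (2 * ((k + 1 : ℕ) : ℝ))) := by
        gcongr
        refine (gaussianMoment_succ_le hk).trans ?_
        gcongr
        linarith
    _ = _ := by
        rw [← mul_pow, ← Real.rpow_natCast, ← Real.rpow_mul (by positivity)]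
        congr 1
        field_simp

theorem sum_abs_boolSign_rpow_le {m : ℕ} {r : ℝ} (hr : 2 ≤ r) (a : Fin m → ℝ) :
    ((2 : ℝ) ^ m)⁻¹ * ∑ ε : Fin m → Bool, |∑ i, boolSign (ε i) * a i| ^ r ≤
      r ^ (r / 2) * (m : ℝ) ^ (r / 2 - 1) * ∑ i, |a i| ^ r := by
  refine (khintchine hr a).trans ?_
  have hσ : 0 ≤ ∑ i, a i ^ 2 := Finset.sum_nonneg fun _ _ => sq_nonneg _
  rw [Real.mul_rpow (by linarith) hσ, mul_assoc]
  gcongr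
  have h := Real.rpow_sum_le_const_mul_sum_rpow_of_nonneg (s := Finset.univ)
    (f := fun j => a j ^ 2) (p := r / 2) (by linarith) (fun _ _ => by positivity)
  rw [Finset.card_univ, Fintype.card_fin] at h
  refine h.trans_eq ?_
  congr 1
  refine Finset.sum_congr rfl fun i _ => ?_
  rw [← sq_abs, ← Real.rpow_natCast, ← Real.rpow_mul (abs_nonneg _)]
  congr 1
  push_cast
  ring

theorem sum_abs_boolSign_rpow_le_of_le_two {m : ℕ} {r : ℝ} (hr : 0 < r) (hr2 : r ≤ 2)
    (a : Fin m → ℝ) :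
    ((2 : ℝ) ^ m)⁻¹ * ∑ ε : Fin m → Bool, |∑ i, boolSign (ε i) * a i| ^ r ≤ ∑ i, |a i| ^ r := by
  refine (sum_abs_boolSign_rpow_le_of_even hr le_rfl (by simpa using hr2) a).trans ?_
  have h := vecLpNorm_antitone (ENNReal.ofReal_pos.2 hr) (ENNReal.ofReal_le_ofReal hr2) a
  have h' := Real.rpow_le_rpow (vecLpNorm_nonneg _ _) h hr.le
  rw [vecLpNorm_ofReal_rpow hr, vecLpNorm_ofReal zero_le_two, ← Real.rpow_mul (by positivity)] at h'
  refine le_trans (le_of_eq ?_) h'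
  simp [gaussianMoment]
  congr 1
  ring

theorem mean_vecLpNorm_sum_le {m N : ℕ} {r D : ℝ} (hr : 1 ≤ r) (hD : 0 ≤ D)
    (h : ∀ a : Fin m → ℝ, ((2 : ℝ) ^ m)⁻¹ * ∑ ε : Fin m → Bool,
      |∑ i, boolSign (ε i) * a i| ^ r ≤ D * ∑ i, |a i| ^ r)
    (v : Fin m → Fin N → ℝ) {V : ℝ} (hV0 : 0 ≤ V)
    (hV : ∀ i, vecLpNorm (ENNReal.ofReal r) (v i) ≤ V) :
    ((2 : ℝ) ^ m)⁻¹ * ∑ ε : Fin m → Bool,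
      vecLpNorm (ENNReal.ofReal r) (fun j => ∑ i, boolSign (ε i) * v i j) ≤
      (D * m) ^ (1 / r) * V := by
  have hr0 : 0 < r := by linarith
  refine (sign_mean_le_rpow_mean hr _ fun _ => vecLpNorm_nonneg _ _).trans ?_
  rw [one_div, Real.rpow_inv_le_iff_of_pos
    (mul_nonneg (by positivity) (Finset.sum_nonneg fun _ _ =>
      Real.rpow_nonneg (vecLpNorm_nonneg _ _) _)) (by positivity) hr0,
    Real.mul_rpow (by positivity) hV0, Real.rpow_inv_rpow (by positivity) hr0.ne']
  simp_rw [vecLpNorm_ofReal_rpow hr0]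
  rw [Finset.sum_comm, Finset.mul_sum]
  calc _ ≤ ∑ j, D * ∑ i, |v i j| ^ r := Finset.sum_le_sum fun j _ => h fun i => v i j
    _ = D * ∑ i, vecLpNorm (ENNReal.ofReal r) (v i) ^ r := by
        simp_rw [vecLpNorm_ofReal_rpow hr0]
        rw [← Finset.mul_sum, Finset.sum_comm]
    _ ≤ D * ∑ _i : Fin m, V ^ r := by
        gcongr with i
        · exact vecLpNorm_nonneg _ _
        · exact hV i
    _ = _ := by simp; ring

theorem mean_vecLpNorm_sum_le_sqrt {m N : ℕ} {r : ℝ} (hm : 1 ≤ m) (hr : 2 ≤ r)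
    (v : Fin m → Fin N → ℝ) {V : ℝ} (hV0 : 0 ≤ V)
    (hV : ∀ i, vecLpNorm (ENNReal.ofReal r) (v i) ≤ V) :
    ((2 : ℝ) ^ m)⁻¹ * ∑ ε : Fin m → Bool,
      vecLpNorm (ENNReal.ofReal r) (fun j => ∑ i, boolSign (ε i) * v i j) ≤
      √r * √m * V := by
  have hr0 : 0 < r := by linarith
  have hm0 : (0 : ℝ) < m := by exact_mod_cast hm
  refine (mean_vecLpNorm_sum_le (by linarith) (by positivity) (sum_abs_boolSign_rpow_le hr)
    v hV0 hV).trans_eq ?_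
  congr 1
  rw [mul_assoc, ← Real.rpow_add_one hm0.ne', sub_add_cancel,
    ← Real.mul_rpow hr0.le hm0.le, ← Real.rpow_mul (by positivity), ← Real.sqrt_mul hr0.le,
    Real.sqrt_eq_rpow]
  congr 1
  field_simp

theorem mean_vecLpNorm_sum_le_sqrt_log {m n : ℕ} {t : ℝ≥0∞} (hm : 1 ≤ m) (hn : 1 ≤ n)
    (ht : ENNReal.ofReal (4 * n) ≤ t) (v : Fin m → Fin (4 ^ n) → ℝ) {V : ℝ} (hV0 : 0 ≤ V)
    (hV : ∀ i, vecLpNorm t (v i) ≤ V) :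
    ((2 : ℝ) ^ m)⁻¹ * ∑ ε : Fin m → Bool,
      vecLpNorm t (fun j => ∑ i, boolSign (ε i) * v i j) ≤ √(8 * n) * √m * V := by
  have hn1 : (1 : ℝ) ≤ n := by exact_mod_cast hn
  have hs : 0 < ENNReal.ofReal (4 * n) := ENNReal.ofReal_pos.2 (by positivity)
  have hN : ((4 ^ n : ℕ) : ℝ) ^ (4 * (n : ℝ))⁻¹ = √2 := by
    push_cast
    rw [← Real.rpow_natCast, ← Real.rpow_mul (by norm_num), Real.sqrt_eq_rpow,
      show (4 : ℝ) = 2 ^ (2 : ℝ) by norm_num, ← Real.rpow_mul (by norm_num)]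
    congr 1
    field_simp
    norm_num
  have hv : ∀ i, vecLpNorm (ENNReal.ofReal (4 * n)) (v i) ≤ √2 * V := fun i => by
    refine (vecLpNorm_le_card_rpow_mul hs ht _).trans ?_
    rw [Fintype.card_fin, ← hN]
    refine mul_le_mul ?_ (hV i) (vecLpNorm_nonneg _ _) (by positivity)
    refine Real.rpow_le_rpow_of_exponent_le (by exact_mod_cast Nat.one_le_pow _ _ (by norm_num)) ?_
    rw [ENNReal.toReal_inv, ENNReal.toReal_ofReal (by positivity)]
    have : 0 ≤ t⁻¹.toReal := ENNReal.toReal_nonneg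
    linarith
  calc _ ≤ ((2 : ℝ) ^ m)⁻¹ * ∑ ε : Fin m → Bool,
      vecLpNorm (ENNReal.ofReal (4 * n)) (fun j => ∑ i, boolSign (ε i) * v i j) := by
        gcongr
        exact vecLpNorm_antitone hs ht _
    _ ≤ √(4 * n) * √m * (√2 * V) :=
        mean_vecLpNorm_sum_le_sqrt hm (by linarith) v (by positivity) hv
    _ = √(8 * n) * √m * V := by
        rw [show (8 : ℝ) * n = 4 * n * 2 by ring, Real.sqrt_mul (by positivity) 2]
        ring

theorem mean_vecLpNorm_hconj_le {m n : ℕ} {p : ℝ} (hm : 1 ≤ m) (hn : 1 ≤ n) (hp : 1 ≤ p)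
    (hp2 : p ≤ 2) (v : Fin m → Fin (4 ^ n) → ℝ) {V : ℝ} (hV0 : 0 ≤ V)
    (hV : ∀ i, vecLpNorm (hconj p) (v i) ≤ V) :
    ((2 : ℝ) ^ m)⁻¹ * ∑ ε : Fin m → Bool,
      vecLpNorm (hconj p) (fun j => ∑ i, boolSign (ε i) * v i j) ≤
      √(minConj p n) * √m * V := by
  unfold minConj
  split_ifs with h
  · exact mean_vecLpNorm_sum_le_sqrt_log hm hn (by simp [hconj, h]) v hV0 hV
  · have h1 : 0 < p - 1 := sub_pos.2 (lt_of_le_of_ne hp (Ne.symm h))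
    rw [hconj, if_neg h] at hV ⊢
    rcases le_total (p / (p - 1)) (8 * n) with h8 | h8
    · rw [min_eq_left h8]
      exact mean_vecLpNorm_sum_le_sqrt hm ((le_div_iff₀ h1).2 (by linarith)) v hV0 hV
    · rw [min_eq_right h8]
      refine mean_vecLpNorm_sum_le_sqrt_log hm hn (ENNReal.ofReal_le_ofReal ?_) v hV0 hV
      have : (0 : ℝ) ≤ n := by positivity
      linarith

theorem mean_vecLpNorm_hconj_le_of_two_lt {m N : ℕ} {p : ℝ} (hm : 1 ≤ m)
    (hp2 : 2 < p) (v : Fin m → Fin N → ℝ) {V : ℝ} (hV0 : 0 ≤ V)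
    (hV : ∀ i, vecLpNorm (hconj p) (v i) ≤ V) :
    ((2 : ℝ) ^ m)⁻¹ * ∑ ε : Fin m → Bool,
      vecLpNorm (hconj p) (fun j => ∑ i, boolSign (ε i) * v i j) ≤
      √(p / (p - 1)) * (m / (m : ℝ) ^ (1 / p)) * V := by
  have h1 : 0 < p - 1 := by linarith
  have hm0 : (0 : ℝ) < m := by exact_mod_cast hm
  have hr : 1 ≤ p / (p - 1) := (one_le_div h1).2 (by linarith)
  have hr2 : p / (p - 1) ≤ 2 := (div_le_iff₀ h1).2 (by linarith)
  rw [hconj, if_neg (by linarith)] at hV ⊢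
  refine (mean_vecLpNorm_sum_le hr zero_le_one (fun a => by
    rw [one_mul]
    exact sum_abs_boolSign_rpow_le_of_le_two (by linarith) hr2 a) v hV0 hV).trans ?_
  gcongr
  have e : (1 * (m : ℝ)) ^ (1 / (p / (p - 1))) = m / (m : ℝ) ^ (1 / p) := by
    rw [one_mul, eq_div_iff (by positivity), ← Real.rpow_add hm0]
    nth_rewrite 2 [← Real.rpow_one (m : ℝ)]
    congr 1
    field_simp
    ring
  rw [e]
  exact le_mul_of_one_le_left (by positivity) (Real.one_le_sqrt.2 hr)

/-- Theorem 1: Rademacher complexity of quantum circuits (as a single channel)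
with `(p,q)` group norm of the Pauli-basis representation matrix bounded by `μ`. -/
theorem statement0
    (n₀ n₁ m : ℕ) (hn₀ : 1 ≤ n₀) (hn₁ : 1 ≤ n₁) (hm : 1 ≤ m)
    (p : ℝ) (q : ℝ≥0∞) (hp : 1 ≤ p) (hq : 0 < q)
    (μ : ℝ) (hμ : 0 < μ)
    (α : Fin (4 ^ n₁) → ℝ) (v : Fin m → Fin (4 ^ n₀) → ℝ)
    (𝒞 : Set (Matrix (Fin (4 ^ n₁)) (Fin (4 ^ n₀)) ℝ))
    (hne : 𝒞.Nonempty)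
    (hbdd : ∀ M ∈ 𝒞, groupNorm (ENNReal.ofReal p) q M ≤ μ) :
    let R : ℝ := ((2 : ℝ) ^ m)⁻¹ * ∑ ε : Fin m → Bool, (m : ℝ)⁻¹ *
      (⨆ M : 𝒞, |∑ i, (if ε i then (1 : ℝ) else -1) * (α ⬝ᵥ (M.1.mulVec (v i)))|)
    (p ≤ 2 →
      R ≤ μ * (4 : ℝ) ^ ((n₁ : ℝ) * max (1 - 1 / p) q⁻¹.toReal) *
        (Real.sqrt (minConj p n₀) / Real.sqrt (m : ℝ)) *
        vecLpNorm (ENNReal.ofReal p) α * (⨆ i, vecLpNorm (hconj p) (v i))) ∧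
    (2 < p →
      R ≤ μ * (4 : ℝ) ^ ((n₁ : ℝ) * max (1 - 1 / p) q⁻¹.toReal) *
        (Real.sqrt (p / (p - 1)) / (m : ℝ) ^ (1 / p)) *
        vecLpNorm (ENNReal.ofReal p) α * (⨆ i, vecLpNorm (hconj p) (v i))) := by
  intro R
  have hm0 : (0 : ℝ) < m := by exact_mod_cast hm
  have hV0 : 0 ≤ ⨆ i, vecLpNorm (hconj p) (v i) :=
    Real.iSup_nonneg fun _ => vecLpNorm_nonneg _ _
  have hV : ∀ i, vecLpNorm (hconj p) (v i) ≤ ⨆ i, vecLpNorm (hconj p) (v i) := fun i =>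
    le_ciSup (f := fun i => vecLpNorm (hconj p) (v i)) (Set.finite_range _).bddAbove i
  set V := ⨆ i, vecLpNorm (hconj p) (v i)
  have hA := vecLpNorm_nonneg (ENNReal.ofReal p) α
  set A := vecLpNorm (ENNReal.ofReal p) α
  set C := (4 : ℝ) ^ ((n₁ : ℝ) * max (1 - 1 / p) q⁻¹.toReal) with hC
  have hC0 : 0 ≤ C := by positivity
  have hR : ∀ B : ℝ, ((2 : ℝ) ^ m)⁻¹ * ∑ ε : Fin m → Bool,
      vecLpNorm (hconj p) (fun j => ∑ i, boolSign (ε i) * v i j) ≤ B →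
      R ≤ μ * C * A * (m : ℝ)⁻¹ * B := by
    intro B hB
    have hsup : ∀ ε : Fin m → Bool,
        (⨆ M : 𝒞, |∑ i, (if ε i then (1 : ℝ) else -1) * (α ⬝ᵥ (M.1.mulVec (v i)))|) ≤
        A * (C * μ * vecLpNorm (hconj p) (fun j => ∑ i, boolSign (ε i) * v i j)) := by
      intro ε
      have : Nonempty 𝒞 := hne.to_subtype
      refine ciSup_le fun M => ?_
      have e : ∑ i, (if ε i then (1 : ℝ) else -1) * (α ⬝ᵥ (M.1.mulVec (v i))) =
          α ⬝ᵥ M.1.mulVec (fun j => ∑ i, boolSign (ε i) * v i j) := by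
        have : (fun j => ∑ i, boolSign (ε i) * v i j) = ∑ i, boolSign (ε i) • v i := by
          ext j
          simp
        rw [this, Matrix.mulVec_sum, dotProduct_sum]
        simp only [Matrix.mulVec_smul, dotProduct_smul, smul_eq_mul, boolSign]
      rw [e]
      refine (abs_dotProduct_mulVec_le hp hq M.1 α _).trans ?_
      rw [Fintype.card_fin, Nat.cast_pow, Nat.cast_ofNat, ← Real.rpow_natCast,
        ← Real.rpow_mul (by norm_num), ← hC]
      have := vecLpNorm_nonneg (hconj p) (fun j => ∑ i, boolSign (ε i) * v i j)
      gcongr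
      exact hbdd M.1 M.2
    calc R ≤ ((2 : ℝ) ^ m)⁻¹ * ∑ ε : Fin m → Bool, (m : ℝ)⁻¹ *
          (A * (C * μ * vecLpNorm (hconj p) (fun j => ∑ i, boolSign (ε i) * v i j))) := by
          simp only [R]
          gcongr with ε
          exact hsup ε
      _ = μ * C * A * (m : ℝ)⁻¹ * (((2 : ℝ) ^ m)⁻¹ * ∑ ε : Fin m → Bool,
          vecLpNorm (hconj p) (fun j => ∑ i, boolSign (ε i) * v i j)) := by
          simp only [Finset.mul_sum]
          exact Finset.sum_congr rfl fun _ _ => by ring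
      _ ≤ _ := by gcongr
  refine ⟨fun hp2 => ?_, fun hp2 => ?_⟩
  · refine (hR _ (mean_vecLpNorm_hconj_le hm hn₀ hp hp2 v hV0 hV)).trans_eq ?_
    have : (m : ℝ)⁻¹ * √m = 1 / √m := by
      rw [inv_mul_eq_div, Real.sqrt_div_self']
    calc _ = μ * C * (√(minConj p n₀) * ((m : ℝ)⁻¹ * √m)) * A * V := by ring
      _ = _ := by rw [this]; ring
  · refine (hR _ (mean_vecLpNorm_hconj_le_of_two_lt hm hp2 v hV0 hV)).trans_eq ?_
    field_simp
end

section
/- Let (M_l, …, M_1) be a tuple of real matrices with M_k of size N_k×N_{k−1}. Then for every 0 < p ≤ 1 and 0 < q ≤ ∞, the (p,q) path norm dominates the (p,q) group norm of the matrix product: γ_{p,q}(M_l, …, M_1) ≥ ‖M_l M_{l−1} ⋯ M_1‖_{p,q}. -/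
open scoped ENNReal BigOperators
open Matrix

/-- `pathP ι p M l z` is the sum over all paths `v₀ → v₁ → ⋯ → v_l = z` of the
`p`-th powers `|[M_l]_{z,v_{l-1}} ⋯ [M_1]_{v_1,v_0}|^p`; so the path quantity
`γ^{(z)}_p` of the depth-`l` tuple `(M_l, …, M_1)` is `(pathP ι p M l z) ^ (1/p)`. -/
noncomputable def pathP (ι : ℕ → Type*) [∀ k, Fintype (ι k)] (p : ℝ)
    (M : ∀ k, Matrix (ι (k + 1)) (ι k) ℝ) : ∀ l, ι l → ℝ
  | 0, _ => 1
  | l + 1, z => ∑ y, |M l z y| ^ p * pathP ι p M l y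

/-- The `(p,q)` path norm `γ_{p,q}` of the depth-`l` tuple `(M_l, …, M_1)`:
`γ_{p,q} = ((1/N_l) ∑_z (γ^{(z)}_p)^q)^{1/q}`, with `γ_{p,∞} = max_z γ^{(z)}_p`. -/
noncomputable def pathNorm (ι : ℕ → Type*) [∀ k, Fintype (ι k)] (p : ℝ) (q : ℝ≥0∞)
    (M : ∀ k, Matrix (ι (k + 1)) (ι k) ℝ) (l : ℕ) : ℝ :=
  if q = ∞ then ⨆ z : ι l, pathP ι p M l z ^ (1 / p)
  else ((Fintype.card (ι l) : ℝ)⁻¹ * ∑ z : ι l, (pathP ι p M l z ^ (1 / p)) ^ q.toReal) ^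
    (1 / q.toReal)

/-- The product `M_l M_{l-1} ⋯ M_1` of a chain of matrices. -/
noncomputable def chainProd (N : ℕ → ℕ)
    (M : ∀ k, Matrix (Fin (N (k + 1))) (Fin (N k)) ℝ) :
    ∀ l, Matrix (Fin (N l)) (Fin (N 0)) ℝ
  | 0 => 1
  | l + 1 => M l * chainProd N M l

theorem abs_sum_rpow_le_sum_abs_rpow {ι : Type*} (s : Finset ι) (f : ι → ℝ) {p : ℝ}
    (hp0 : 0 < p) (hp1 : p ≤ 1) : |∑ i ∈ s, f i| ^ p ≤ ∑ i ∈ s, |f i| ^ p := by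
  classical
  induction s using Finset.induction_on with
  | empty => simp [Real.zero_rpow hp0.ne']
  | insert a s ha ih =>
    rw [Finset.sum_insert ha, Finset.sum_insert ha]
    calc |f a + ∑ i ∈ s, f i| ^ p
        ≤ (|f a| + |∑ i ∈ s, f i|) ^ p :=
          Real.rpow_le_rpow (abs_nonneg _) (abs_add_le _ _) hp0.le
      _ ≤ |f a| ^ p + |∑ i ∈ s, f i| ^ p :=
          Real.rpow_add_le_add_rpow (abs_nonneg _) (abs_nonneg _) hp0.le hp1
      _ ≤ _ := by gcongr

theorem sum_abs_chainProd_rpow_le_pathP (N : ℕ → ℕ)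
    (M : ∀ k, Matrix (Fin (N (k + 1))) (Fin (N k)) ℝ) {p : ℝ} (hp0 : 0 < p) (hp1 : p ≤ 1)
    (l : ℕ) (z : Fin (N l)) :
    ∑ j, |chainProd N M l z j| ^ p ≤ pathP (fun k => Fin (N k)) p M l z := by
  induction l with
  | zero =>
    simp [chainProd, pathP, Matrix.one_apply, apply_ite abs, hp0.ne',
      apply_ite (fun x : ℝ => x ^ p)]
  | succ l ih =>
    calc ∑ j, |chainProd N M (l + 1) z j| ^ p
        ≤ ∑ j, ∑ y, |M l z y * chainProd N M l y j| ^ p :=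
          Finset.sum_le_sum fun j _ => by
            rw [chainProd, Matrix.mul_apply]
            exact abs_sum_rpow_le_sum_abs_rpow _ _ hp0 hp1
      _ = ∑ y, |M l z y| ^ p * ∑ j, |chainProd N M l y j| ^ p := by
          rw [Finset.sum_comm]
          simp only [abs_mul, Real.mul_rpow (abs_nonneg _) (abs_nonneg _), Finset.mul_sum]
      _ ≤ pathP (fun k => Fin (N k)) p M (l + 1) z :=
          Finset.sum_le_sum fun y _ => mul_le_mul_of_nonneg_left (ih y) (by positivity)

theorem vecLpNorm_chainProd_le (N : ℕ → ℕ)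
    (M : ∀ k, Matrix (Fin (N (k + 1))) (Fin (N k)) ℝ) {p : ℝ} (hp0 : 0 < p) (hp1 : p ≤ 1)
    (l : ℕ) (z : Fin (N l)) :
    vecLpNorm (ENNReal.ofReal p) (chainProd N M l z) ≤
      pathP (fun k => Fin (N k)) p M l z ^ (1 / p) := by
  rw [vecLpNorm, if_neg ENNReal.ofReal_ne_top, ENNReal.toReal_ofReal hp0.le]
  exact Real.rpow_le_rpow (by positivity) (sum_abs_chainProd_rpow_le_pathP N M hp0 hp1 l z)
    (by positivity)

/-- For `0 < p ≤ 1`, the `(p,q)` path norm of a tuple dominates the `(p,q)` group norm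
of the product of the matrices. -/
theorem statement17 (l : ℕ) (N : ℕ → ℕ)
    (M : ∀ k, Matrix (Fin (N (k + 1))) (Fin (N k)) ℝ)
    (p : ℝ) (hp0 : 0 < p) (hp1 : p ≤ 1) (q : ℝ≥0∞) (hq : 0 < q) :
    groupNorm (ENNReal.ofReal p) q (chainProd N M l) ≤
      pathNorm (fun k => Fin (N k)) p q M l := by
  have h := vecLpNorm_chainProd_le N M hp0 hp1 l
  unfold groupNorm pathNorm
  split_ifs
  · exact ciSup_mono (Set.finite_range _).bddAbove h
  · have h_nonneg (i : Fin (N l)) := vecLpNorm_nonneg (ENNReal.ofReal p) (chainProd N M l i)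
    refine Real.rpow_le_rpow ?_ ?_ (by positivity)
    · exact mul_nonneg (by positivity)
        (Finset.sum_nonneg fun i _ => Real.rpow_nonneg (h_nonneg i) _)
    · exact mul_le_mul_of_nonneg_left
        (Finset.sum_le_sum fun i _ =>
          Real.rpow_le_rpow (h_nonneg i) (h i) ENNReal.toReal_nonneg) (by positivity)
end

section
/- Let C⃗_l = (M_l, …, M_1) be a tuple of real matrices with M_k of size N_k×N_{k−1}, and let C⃗_m = (M'_m, …, M'_1) be a tuple of real matrices with M'_j of size N'_j×N'_{j−1}, where N'_m = N_0 (so that the concatenated tuple C⃗_l ∘ C⃗_m = (M_l, …, M_1, M'_m, …, M'_1), which applies C⃗_m first, is well defined). Then for every 0 < p < ∞ and 0 < q ≤ ∞, the (p,q) path norm satisfies γ_{p,q}(C⃗_l ∘ C⃗_m) ≤ γ_{p,q}(C⃗_l) · γ_{p,∞}(C⃗_m). -/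
open scoped ENNReal BigOperators
open Matrix

theorem pathP_nonneg (ι : ℕ → Type*) [∀ k, Fintype (ι k)] (p : ℝ)
    (M : ∀ k, Matrix (ι (k + 1)) (ι k) ℝ) : ∀ l (z : ι l), 0 ≤ pathP ι p M l z
  | 0, _ => zero_le_one
  | l + 1, _ => Finset.sum_nonneg fun y _ =>
      mul_nonneg (Real.rpow_nonneg (abs_nonneg _) _) (pathP_nonneg ι p M l y)

theorem pathP_add_le (ι : ℕ → Type*) [∀ k, Fintype (ι k)] (p : ℝ)
    (M : ∀ k, Matrix (ι (k + 1)) (ι k) ℝ) (m : ℕ) {C : ℝ} (hC : ∀ z, pathP ι p M m z ≤ C) :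
    ∀ l (z : ι (m + l)), pathP ι p M (m + l) z ≤
      pathP (fun k => ι (m + k)) p (fun k => M (m + k)) l z * C
  | 0, z => (hC z).trans_eq (one_mul C).symm
  | l + 1, z => by
    change ∑ y, |M (m + l) z y| ^ p * pathP ι p M (m + l) y ≤
      (∑ y, |M (m + l) z y| ^ p * pathP (fun k => ι (m + k)) p (fun k => M (m + k)) l y) * C
    rw [Finset.sum_mul]
    refine Finset.sum_le_sum fun y _ => ?_
    rw [mul_assoc]
    exact mul_le_mul_of_nonneg_left (pathP_add_le ι p M m hC l y)
      (Real.rpow_nonneg (abs_nonneg _) _)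

theorem pathNorm_top_nonneg (ι : ℕ → Type*) [∀ k, Fintype (ι k)] (p : ℝ)
    (M : ∀ k, Matrix (ι (k + 1)) (ι k) ℝ) (l : ℕ) : 0 ≤ pathNorm ι p ∞ M l := by
  rw [pathNorm, if_pos rfl]
  exact Real.iSup_nonneg fun z => Real.rpow_nonneg (pathP_nonneg ι p M l z) _

theorem rpow_pathP_le_pathNorm_top (ι : ℕ → Type*) [∀ k, Fintype (ι k)] (p : ℝ)
    (M : ∀ k, Matrix (ι (k + 1)) (ι k) ℝ) (l : ℕ) (z : ι l) :
    pathP ι p M l z ^ (1 / p) ≤ pathNorm ι p ∞ M l := by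
  rw [pathNorm, if_pos rfl]
  exact le_ciSup (f := fun z => pathP ι p M l z ^ (1 / p)) (Set.finite_range _).bddAbove z

theorem rpow_pathP_add_le (ι : ℕ → Type*) [∀ k, Fintype (ι k)] {p : ℝ} (hp : 0 < p)
    (M : ∀ k, Matrix (ι (k + 1)) (ι k) ℝ) (m l : ℕ) (z : ι (m + l)) :
    pathP ι p M (m + l) z ^ (1 / p) ≤
      pathP (fun k => ι (m + k)) p (fun k => M (m + k)) l z ^ (1 / p) * pathNorm ι p ∞ M m := by
  have hG := pathNorm_top_nonneg ι p M m
  have hC : ∀ y, pathP ι p M m y ≤ pathNorm ι p ∞ M m ^ p := fun y => by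
    have h := Real.rpow_le_rpow (Real.rpow_nonneg (pathP_nonneg ι p M m y) _)
      (rpow_pathP_le_pathNorm_top ι p M m y) hp.le
    rwa [one_div, Real.rpow_inv_rpow (pathP_nonneg ι p M m y) hp.ne'] at h
  refine (Real.rpow_le_rpow (pathP_nonneg ι p M _ z) (pathP_add_le ι p M m hC l z)
    (by positivity)).trans_eq ?_
  rw [Real.mul_rpow (pathP_nonneg (fun k => ι (m + k)) p _ l z) (Real.rpow_nonneg hG p), one_div,
    Real.rpow_rpow_inv hG hp.ne']

/-- Submultiplicativity of the path norm under concatenation of circuits: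
`γ_{p,q}(C_l ∘ C_m) ≤ γ_{p,q}(C_l) · γ_{p,∞}(C_m)`, where the concatenation applies the
`m` layers `M_0, …, M_{m-1}` first and then the `l` layers `M_m, …, M_{m+l-1}`. -/
theorem statement18 (l m : ℕ) (N : ℕ → ℕ)
    (M : ∀ k, Matrix (Fin (N (k + 1))) (Fin (N k)) ℝ)
    (p : ℝ) (hp : 0 < p) (q : ℝ≥0∞) (hq : 0 < q) :
    pathNorm (fun k => Fin (N k)) p q M (m + l) ≤
      pathNorm (fun k => Fin (N (m + k))) p q (fun k => M (m + k)) l *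
        pathNorm (fun k => Fin (N k)) p ∞ M m := by
  have key := rpow_pathP_add_le (fun k => Fin (N k)) hp M m l
  have hP := pathP_nonneg (fun k => Fin (N k)) p M (m + l)
  have hP' := pathP_nonneg (fun k => Fin (N (m + k))) p (fun k => M (m + k)) l
  have hG := pathNorm_top_nonneg (fun k => Fin (N k)) p M m
  by_cases hq' : q = ∞
  · subst hq'
    rw [pathNorm, if_pos rfl]
    refine Real.iSup_le (fun z => (key z).trans ?_)
      (mul_nonneg (pathNorm_top_nonneg _ _ _ _) hG)
    exact mul_le_mul_of_nonneg_right
      (rpow_pathP_le_pathNorm_top (fun k => Fin (N (m + k))) p _ l z) hG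
  · have hr : 0 < q.toReal := ENNReal.toReal_pos hq.ne' hq'
    generalize pathNorm (fun k => Fin (N k)) p ∞ M m = G at key hG ⊢
    rw [pathNorm, pathNorm, if_neg hq', if_neg hq']
    have hS : 0 ≤ (Fintype.card (Fin (N (m + l))) : ℝ)⁻¹ * ∑ z : Fin (N (m + l)),
        (pathP (fun k => Fin (N (m + k))) p (fun k => M (m + k)) l z ^ (1 / p)) ^ q.toReal :=
      mul_nonneg (by positivity) (Finset.sum_nonneg fun z _ =>
        Real.rpow_nonneg (Real.rpow_nonneg (hP' z) _) _)
    have hG' : G = (G ^ q.toReal) ^ (1 / q.toReal) := by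
      rw [one_div, Real.rpow_rpow_inv hG hr.ne']
    rw [hG', ← Real.mul_rpow hS (Real.rpow_nonneg hG _), mul_assoc, Finset.sum_mul]
    refine Real.rpow_le_rpow (mul_nonneg (by positivity) (Finset.sum_nonneg fun z _ =>
      Real.rpow_nonneg (Real.rpow_nonneg (hP z) _) _)) ?_ (by positivity)
    refine mul_le_mul_of_nonneg_left (Finset.sum_le_sum fun z _ => ?_) (by positivity)
    rw [← Real.mul_rpow (Real.rpow_nonneg (hP' z) _) hG]
    exact Real.rpow_le_rpow (Real.rpow_nonneg (hP z) _) (key z) hr.le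
end
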